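/- Let σ² > 1/2 and set ρ = 1 − 1/(2σ²). Let α > 0 and β > 0. Let (x_1, x_2, z_1, z_2) be zero-mean jointly Gaussian with E[x_1²] = E[x_2²] = σ², E[x_1 x_2] = ρσ², E[z_1²] = ασ², E[z_2²] = βσ², and with z_1, z_2, and (x_1, x_2) mutually independent. Set u_1 = x_1 + z_1, u_2 = x_2 + z_2, and x_3 = x_1 − x_2 (so that x_3 has variance 1). Then E[(x_3 − E[x_3 | u_1, u_2])²] = 1 − (1/σ²) · (2(1 + ρ) + α + β) / (4(1 + α)(1 + β) − 4ρ²). -/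

import Mathlib

open MeasureTheory ProbabilityTheory

/-- A finite family of real random variables is *jointly Gaussian* if every linear
combination of them has a (possibly degenerate) Gaussian distribution. -/
def IsJointlyGaussian {Ω ι : Type*} [MeasurableSpace Ω] [Fintype ι]
    (μ : Measure Ω) (X : ι → Ω → ℝ) : Prop :=
  ∀ c : ι → ℝ, ∃ (m : ℝ) (v : NNReal),
    Measure.map (fun ω => ∑ i, c i * X i ω) μ = gaussianReal m v

/-- A jointly Gaussian family of measurable variables is a Gaussian vector. -/
lemma IsJointlyGaussian.hasGaussianLaw {Ω ι : Type*} [MeasurableSpace Ω] [Fintype ι]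
    {μ : Measure Ω} {X : ι → Ω → ℝ} (h : IsJointlyGaussian μ X) (hX : ∀ i, Measurable (X i)) :
    HasGaussianLaw (fun ω i ↦ X i ω) μ where
  isGaussian_map := by
    classical
    refine isGaussian_of_map_eq_gaussianReal fun L ↦ ?_
    obtain ⟨m, v, hmv⟩ := h fun i ↦ L (Pi.single i 1)
    refine ⟨m, v, ?_⟩
    rw [Measure.map_map (by fun_prop) (by fun_prop), ← hmv]
    congr 1
    ext ω
    conv_lhs => rw [Function.comp_apply, ← Finset.univ_sum_single (fun i ↦ X i ω), map_sum]
    refine Finset.sum_congr rfl fun i _ ↦ ?_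
    rw [show Pi.single i (X i ω) = X i ω • (Pi.single i 1 : ι → ℝ) by
      rw [← Pi.single_smul, smul_eq_mul, mul_one], map_smul, smul_eq_mul, mul_comm]

/-- If `(X, U)` is Gaussian and the residual `X - L U` is centred and uncorrelated with `U`, then
the linear estimate `L U` is the conditional expectation of `X` given `U`. -/
lemma ProbabilityTheory.HasGaussianLaw.condExp_ae_eq_linear {Ω E : Type*} {mΩ : MeasurableSpace Ω}
    [NormedAddCommGroup E] [NormedSpace ℝ E] [MeasurableSpace E] [BorelSpace E] [CompleteSpace E]
    [SecondCountableTopology E] {μ : Measure Ω} {X : Ω → ℝ} {U : Ω → E}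
    (h : HasGaussianLaw (fun ω ↦ (X ω, U ω)) μ) (hX : Measurable X) (hU : Measurable U)
    (L : StrongDual ℝ E) (hmean : ∫ ω, X ω - L (U ω) ∂μ = 0)
    (hcov : ∀ L' : StrongDual ℝ E, cov[fun ω ↦ X ω - L (U ω), fun ω ↦ L' (U ω); μ] = 0) :
    μ[X | MeasurableSpace.comap U inferInstance] =ᵐ[μ] fun ω ↦ L (U ω) := by
  have := h.isProbabilityMeasure
  have hres : HasGaussianLaw (fun ω ↦ (X ω - L (U ω), U ω)) μ :=
    h.map_fun ((ContinuousLinearMap.fst ℝ ℝ E - L ∘L ContinuousLinearMap.snd ℝ ℝ E).prod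
      (ContinuousLinearMap.snd ℝ ℝ E))
  have hindep : IndepFun (fun ω ↦ X ω - L (U ω)) U μ := by
    refine hres.indepFun_of_covariance_strongDual fun L₁ L₂ ↦ ?_
    have hL₁ : L₁ ∘ (fun ω ↦ X ω - L (U ω)) = fun ω ↦ L₁ 1 * (X ω - L (U ω)) := by
      ext ω
      simpa [mul_comm] using L₁.map_smul (X ω - L (U ω)) 1
    rw [hL₁, covariance_const_mul_left]
    exact mul_eq_zero_of_right _ (hcov L₂)
  have hsplit : X = (fun ω ↦ X ω - L (U ω)) + fun ω ↦ L (U ω) := by ext; simp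
  have hLU : Integrable (fun ω ↦ L (U ω)) μ := (h.snd.map_fun L).integrable
  have hres_condExp := condExp_indep_eq (f := fun ω ↦ X ω - L (U ω))
    (by fun_prop : Measurable fun ω ↦ X ω - L (U ω)).comap_le hU.comap_le
    (comap_measurable _).stronglyMeasurable hindep
  have hLU_condExp : μ[fun ω ↦ L (U ω) | MeasurableSpace.comap U inferInstance]
      = fun ω ↦ L (U ω) :=
    condExp_of_stronglyMeasurable hU.comap_le
      (L.continuous.measurable.comp (comap_measurable U)).stronglyMeasurable hLU
  have hadd := condExp_add hres.fst.integrable hLU (MeasurableSpace.comap U inferInstance)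
  rw [← hsplit] at hadd
  filter_upwards [hadd, hres_condExp] with ω h₁ h₂
  rw [h₁, Pi.add_apply, h₂, hmean, hLU_condExp, zero_add]

/-- The mixed second moment of two linear combinations. -/
lemma integral_sum_mul_sum {Ω ι : Type*} [MeasurableSpace Ω] [Fintype ι] {μ : Measure Ω}
    {X : ι → Ω → ℝ} (hX : ∀ i, MemLp (X i) 2 μ) (c d : ι → ℝ) :
    ∫ ω, (∑ i, c i * X i ω) * (∑ j, d j * X j ω) ∂μ
      = ∑ i, ∑ j, c i * d j * ∫ ω, X i ω * X j ω ∂μ := by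
  have hint : ∀ i j, Integrable (fun ω ↦ c i * d j * (X i ω * X j ω)) μ := fun i j ↦
    ((hX i).integrable_mul (hX j)).const_mul _
  simp_rw [Finset.sum_mul_sum, fun i j ω ↦ mul_mul_mul_comm (c i) (X i ω) (d j) (X j ω)]
  rw [integral_finsetSum _ fun i _ ↦ integrable_finsetSum _ fun j _ ↦ hint i j]
  simp_rw [integral_finsetSum _ fun j _ ↦ hint _ j, integral_const_mul]

/-- Let `σ² = s > 1/2` and `ρ = 1 − 1/(2s)`.  Let `α, β > 0` and let
`(x₁, x₂, z₁, z₂)` be zero-mean jointly Gaussian with `E[x₁²] = E[x₂²] = s`,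
`E[x₁ x₂] = ρ s`, `E[z₁²] = α s`, `E[z₂²] = β s`, and with `(x₁, x₂)`, `z₁`, `z₂`
mutually independent (their joint law is the product of the three laws).  Set
`u₁ = x₁ + z₁`, `u₂ = x₂ + z₂` and `x₃ = x₁ − x₂`.  Then
`E[(x₃ − E[x₃ | u₁, u₂])²] = 1 − (1/s) ⬝ (2(1 + ρ) + α + β)/(4(1 + α)(1 + β) − 4ρ²)`. -/
theorem mmse_of_difference_given_noisy_observations
    {Ω : Type*} [MeasurableSpace Ω] (μ : Measure Ω) [IsProbabilityMeasure μ]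
    (s : ℝ) (hs : 1 / 2 < s) (ρ : ℝ) (hρ : ρ = 1 - 1 / (2 * s))
    (α β : ℝ) (hα : 0 < α) (hβ : 0 < β)
    (x₁ x₂ z₁ z₂ : Ω → ℝ)
    (hx₁ : Measurable x₁) (hx₂ : Measurable x₂)
    (hz₁ : Measurable z₁) (hz₂ : Measurable z₂)
    (hGauss : IsJointlyGaussian μ ![x₁, x₂, z₁, z₂])
    (hm₁ : ∫ ω, x₁ ω ∂μ = 0) (hm₂ : ∫ ω, x₂ ω ∂μ = 0)
    (hmz₁ : ∫ ω, z₁ ω ∂μ = 0) (hmz₂ : ∫ ω, z₂ ω ∂μ = 0)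
    (hv₁ : ∫ ω, (x₁ ω) ^ 2 ∂μ = s) (hv₂ : ∫ ω, (x₂ ω) ^ 2 ∂μ = s)
    (hcov : ∫ ω, x₁ ω * x₂ ω ∂μ = ρ * s)
    (hvz₁ : ∫ ω, (z₁ ω) ^ 2 ∂μ = α * s) (hvz₂ : ∫ ω, (z₂ ω) ^ 2 ∂μ = β * s)
    (hindep : Measure.map (fun ω => ((x₁ ω, x₂ ω), z₁ ω, z₂ ω)) μ =
      (Measure.map (fun ω => (x₁ ω, x₂ ω)) μ).prod
        ((Measure.map z₁ μ).prod (Measure.map z₂ μ))) :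
    ∫ ω, (x₁ ω - x₂ ω -
        (μ[fun ω' => x₁ ω' - x₂ ω' |
          MeasurableSpace.comap (fun ω' => (x₁ ω' + z₁ ω', x₂ ω' + z₂ ω')) inferInstance]) ω) ^ 2
      ∂μ
      = 1 - (1 / s) * ((2 * (1 + ρ) + α + β) / (4 * (1 + α) * (1 + β) - 4 * ρ ^ 2)) := by
  set X : Fin 4 → Ω → ℝ := ![x₁, x₂, z₁, z₂] with hXdef
  have hXm : ∀ i, Measurable (X i) := by
    intro i
    fin_cases i <;> assumption
  have hXG : HasGaussianLaw (fun ω i ↦ X i ω) μ := hGauss.hasGaussianLaw hXm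
  have hX2 : ∀ i, MemLp (X i) 2 μ := fun i ↦ (hXG.eval i).memLp_two
  have hmean : ∀ i, ∫ ω, X i ω ∂μ = 0 := by
    intro i
    fin_cases i <;> assumption
  have hsum_mean : ∀ c : Fin 4 → ℝ, ∫ ω, ∑ i, c i * X i ω ∂μ = 0 := by
    intro c
    rw [integral_finsetSum _ fun i _ ↦ ((hX2 i).integrable one_le_two).const_mul _]
    simp_rw [integral_const_mul, hmean, mul_zero, Finset.sum_const_zero]
  have hmap_z : μ.map (fun ω ↦ (z₁ ω, z₂ ω)) = (μ.map z₁).prod (μ.map z₂) := by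
    have := Measure.isProbabilityMeasure_map (μ := μ) (hx₁.prodMk hx₂).aemeasurable
    have := congr_arg Measure.snd hindep
    rwa [Measure.snd_prod, Measure.snd_map_prodMk (by fun_prop)] at this
  have hzz : IndepFun z₁ z₂ μ :=
    (indepFun_iff_map_prod_eq_prod_map_map hz₁.aemeasurable hz₂.aemeasurable).2 hmap_z
  have hxz : IndepFun (fun ω ↦ (x₁ ω, x₂ ω)) (fun ω ↦ (z₁ ω, z₂ ω)) μ := by
    rw [indepFun_iff_map_prod_eq_prod_map_map (by fun_prop) (by fun_prop), hmap_z]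
    exact hindep
  have hzero : ∀ {f g : Ω → ℝ}, Measurable f → Measurable g → IndepFun f g μ →
      ∫ ω, f ω ∂μ = 0 → ∫ ω, f ω * g ω ∂μ = 0 := fun hf hg hfg h₀ ↦ by
    rw [hfg.integral_fun_mul_eq_mul_integral hf.aestronglyMeasurable hg.aestronglyMeasurable, h₀,
      zero_mul]
  have h13 : ∫ ω, x₁ ω * z₁ ω ∂μ = 0 :=
    hzero hx₁ hz₁ (hxz.comp measurable_fst measurable_fst) hm₁
  have h14 : ∫ ω, x₁ ω * z₂ ω ∂μ = 0 :=
    hzero hx₁ hz₂ (hxz.comp measurable_fst measurable_snd) hm₁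
  have h23 : ∫ ω, x₂ ω * z₁ ω ∂μ = 0 :=
    hzero hx₂ hz₁ (hxz.comp measurable_snd measurable_fst) hm₂
  have h24 : ∫ ω, x₂ ω * z₂ ω ∂μ = 0 :=
    hzero hx₂ hz₂ (hxz.comp measurable_snd measurable_snd) hm₂
  have h34 : ∫ ω, z₁ ω * z₂ ω ∂μ = 0 := hzero hz₁ hz₂ hzz hmz₁
  have hmoment : ∀ c d : Fin 4 → ℝ,
      ∫ ω, (∑ i, c i * X i ω) * (∑ j, d j * X j ω) ∂μ
        = s * (c 0 * d 0 + c 1 * d 1 + ρ * (c 0 * d 1 + c 1 * d 0)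
          + α * (c 2 * d 2) + β * (c 3 * d 3)) := by
    intro c d
    rw [integral_sum_mul_sum hX2]
    have comm : ∀ f g : Ω → ℝ, ∫ ω, f ω * g ω ∂μ = ∫ ω, g ω * f ω ∂μ := fun f g ↦ by
      simp_rw [mul_comm]
    simp only [Fin.sum_univ_four, hXdef, Matrix.cons_val]
    rw [comm x₂ x₁, comm z₁ x₁, comm z₁ x₂, comm z₂ x₁, comm z₂ x₂, comm z₂ z₁]
    simp_rw [← pow_two]
    rw [h13, h14, h23, h24, h34, hv₁, hv₂, hcov, hvz₁, hvz₂]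
    ring
  have hs0 : 0 < s := by linarith
  have hρ0 : 0 < ρ := by
    rw [hρ, sub_pos, div_lt_one (by linarith)]
    linarith
  have hρ1 : ρ < 1 := by
    rw [hρ]
    have : 0 < 1 / (2 * s) := by positivity
    linarith
  have hsρ : 2 * s * (1 - ρ) = 1 := by
    rw [hρ]
    field_simp
    ring
  obtain ⟨D, hD⟩ : ∃ D, D = (1 + α) * (1 + β) - ρ ^ 2 := ⟨_, rfl⟩
  have hD0 : 0 < D := by
    rw [hD]
    nlinarith [mul_pos hα hβ]
  -- The coefficients of the linear least-squares estimate.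
  obtain ⟨a, ha⟩ : ∃ a, a = (1 - ρ) * (1 + β + ρ) / D := ⟨_, rfl⟩
  obtain ⟨b, hb⟩ : ∃ b, b = -((1 - ρ) * (1 + α + ρ) / D) := ⟨_, rfl⟩
  have haD : a * D = (1 - ρ) * (1 + β + ρ) := by rw [ha]; field_simp
  have hbD : b * D = -((1 - ρ) * (1 + α + ρ)) := by rw [hb]; field_simp
  have normal₁ : a * (1 + α) + b * ρ = 1 - ρ := by
    apply mul_right_cancel₀ hD0.ne'
    linear_combination (1 + α) * haD + ρ * hbD - (1 - ρ) * hD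
  have normal₂ : a * ρ + b * (1 + β) = -(1 - ρ) := by
    apply mul_right_cancel₀ hD0.ne'
    linear_combination ρ * haD + (1 + β) * hbD + (1 - ρ) * hD
  let L : StrongDual ℝ (ℝ × ℝ) :=
    a • ContinuousLinearMap.fst ℝ ℝ ℝ + b • ContinuousLinearMap.snd ℝ ℝ ℝ
  have hL : ∀ p, L p = a * p.1 + b * p.2 := fun p ↦ by simp [L]
  have hres : ∀ ω, x₁ ω - x₂ ω - L (x₁ ω + z₁ ω, x₂ ω + z₂ ω)
      = ∑ i, ![1 - a, -1 - b, -a, -b] i * X i ω := fun ω ↦ by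
    simp only [hL, Fin.sum_univ_four, hXdef, Matrix.cons_val]
    ring
  have hG : HasGaussianLaw (fun ω ↦ (x₁ ω - x₂ ω, x₁ ω + z₁ ω, x₂ ω + z₂ ω)) μ :=
    let p : Fin 4 → (Fin 4 → ℝ) →L[ℝ] ℝ := fun i ↦ ContinuousLinearMap.proj i
    hXG.map_fun ((p 0 - p 1).prod ((p 0 + p 2).prod (p 1 + p 3)))
  have hcond := hG.condExp_ae_eq_linear (by fun_prop) (by fun_prop) L
    (by simp_rw [hres]; exact hsum_mean _) (fun L' ↦ by
      have hL' : ∀ ω, L' (x₁ ω + z₁ ω, x₂ ω + z₂ ω)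
          = ∑ i, ![L' (1, 0), L' (0, 1), L' (1, 0), L' (0, 1)] i * X i ω := fun ω ↦ by
        have : (x₁ ω + z₁ ω, x₂ ω + z₂ ω)
            = (x₁ ω + z₁ ω) • ((1, 0) : ℝ × ℝ) + (x₂ ω + z₂ ω) • ((0, 1) : ℝ × ℝ) := by simp
        rw [this, map_add, map_smul, map_smul]
        simp only [Fin.sum_univ_four, hXdef, Matrix.cons_val, smul_eq_mul]
        ring
      simp_rw [hres, hL']
      have hmem : ∀ c : Fin 4 → ℝ, MemLp (fun ω ↦ ∑ i, c i * X i ω) 2 μ := fun c ↦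
        memLp_finsetSum _ fun i _ ↦ (hX2 i).const_mul _
      rw [covariance_eq_sub (hmem _) (hmem _)]
      simp only [hsum_mean, Pi.mul_apply, mul_zero, sub_zero]
      rw [hmoment]
      simp only [Matrix.cons_val]
      linear_combination -s * L' (1, 0) * normal₁ - s * L' (0, 1) * normal₂)
  have hlhs := integral_congr_ae (hcond.mono fun ω hω ↦
    congr_arg (fun t ↦ (x₁ ω - x₂ ω - t) ^ 2) hω)
  refine hlhs.trans ?_
  simp_rw [hres, pow_two]
  rw [hmoment]
  simp only [Matrix.cons_val]
  have hvalue : s * (1 - ρ) * (a - b) = 1 / s * ((2 * (1 + ρ) + α + β) / (4 * D)) := by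
    have hρs : 1 - ρ = 1 / (2 * s) := by rw [hρ]; ring
    rw [ha, hb, hρs]
    field_simp
    ring
  rw [show 4 * (1 + α) * (1 + β) - 4 * (ρ * ρ) = 4 * D by rw [hD]; ring, ← hvalue]
  linear_combination hsρ + s * a * normal₁ + s * b * normal₂
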